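/- Define, for positive reals t012, e01, e10, e12, e21, the polynomials ⊤_c = e01·e10²·e12²·e21·t012 − e12³ − 1 and ⊥_c = e21³·t012 + t012 − e01²·e10·e12·e21², and set p = (e12³ + 1)/(e01·e10²·e12²·e21) and q = (e01²·e10·e12·e21²)/(e21³ + 1). Then the set { (t012, e01, e10, e12, e21) ∈ (0,∞)⁵ : ⊤_c > 0 and ⊥_c > 0 } equals { (t012, e01, e10, e12, e21) ∈ (0,∞)⁵ : t012 > max(p, q) }, and this set, with its subspace topology, is homeomorphic to ℝ⁵. -/

import Mathlib

/-- `⊤_c`, as a function of `(t012, e01, e10, e12, e21)`. -/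
def topC (t012 e01 e10 e12 e21 : ℝ) : ℝ :=
  e01 * e10 ^ 2 * e12 ^ 2 * e21 * t012 - e12 ^ 3 - 1

/-- `⊥_c`, as a function of `(t012, e01, e10, e12, e21)`. -/
def botC (t012 e01 e10 e12 e21 : ℝ) : ℝ :=
  e21 ^ 3 * t012 + t012 - e01 ^ 2 * e10 * e12 * e21 ^ 2

/-- `p = (e12³+1)/(e01·e10²·e12²·e21)`. -/
noncomputable def pC (e01 e10 e12 e21 : ℝ) : ℝ := (e12 ^ 3 + 1) / (e01 * e10 ^ 2 * e12 ^ 2 * e21)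

/-- `q = (e01²·e10·e12·e21²)/(e21³+1)`. -/
noncomputable def qC (e01 e10 e12 e21 : ℝ) : ℝ := (e01 ^ 2 * e10 * e12 * e21 ^ 2) / (e21 ^ 3 + 1)

/-- The first piece: `⊤_c > 0` and `⊥_c > 0` inside `(0,∞)⁵`, coordinates
`(t012, e01, e10, e12, e21)`. -/
def cyanPosPiece : Set (Fin 5 → ℝ) :=
  {x | (∀ i, 0 < x i) ∧
    0 < topC (x 0) (x 1) (x 2) (x 3) (x 4) ∧
    0 < botC (x 0) (x 1) (x 2) (x 3) (x 4)}

/-- The strict epigraph, over the open positive orthant, of a function continuous there is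
homeomorphic to Euclidean space. -/
noncomputable def strictEpigraphHomeomorph {n : ℕ} (f : (Fin n → ℝ) → ℝ)
    (hf : ContinuousOn f {y | ∀ i, 0 < y i}) :
    {x : Fin (n + 1) → ℝ | (∀ i, 0 < Fin.tail x i) ∧ f (Fin.tail x) < x 0} ≃ₜ
      (Fin (n + 1) → ℝ) where
  toFun x := Fin.cons (Real.log (x.1 0 - f (Fin.tail x.1))) fun i => Real.log (Fin.tail x.1 i)
  invFun y :=
    ⟨Fin.cons (Real.exp (y 0) + f fun i => Real.exp (Fin.tail y i))
      fun i => Real.exp (Fin.tail y i), by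
        simp [Fin.tail_cons, Real.exp_pos]⟩
  left_inv := by
    rintro ⟨x, hx, hfx⟩
    ext i
    have htail : (fun i => Real.exp (Real.log (Fin.tail x i))) = Fin.tail x :=
      funext fun i => Real.exp_log (hx i)
    refine Fin.cases ?_ (fun i => ?_) i
    · simp only [Fin.cons_zero, Fin.tail_cons, htail, Real.exp_log (sub_pos.2 hfx)]
      ring
    · simp only [Fin.cons_succ, Fin.tail_cons, Real.exp_log (hx i)]
      rfl
  right_inv y := by
    ext i
    refine Fin.cases ?_ (fun i => ?_) i
    · simp
    · simp [Fin.tail]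
  continuous_toFun := by
    have htail : Continuous fun x : {x : Fin (n + 1) → ℝ |
        (∀ i, 0 < Fin.tail x i) ∧ f (Fin.tail x) < x 0} => Fin.tail x.1 :=
      continuous_pi fun i => (continuous_apply i.succ).comp continuous_subtype_val
    refine continuous_pi fun i => Fin.cases ?_ (fun i => ?_) i
    · simp only [Fin.cons_zero]
      refine Continuous.log ?_ fun x => (sub_pos.2 x.2.2).ne'
      exact ((continuous_apply 0).comp continuous_subtype_val).sub
        (hf.comp_continuous htail fun x => x.2.1)
    · simp only [Fin.cons_succ]
      exact ((continuous_apply i).comp htail).log fun x => (x.2.1 i).ne'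
  continuous_invFun := by
    have hexp : Continuous fun (y : Fin (n + 1) → ℝ) (i : Fin n) => Real.exp (Fin.tail y i) := by
      unfold Fin.tail
      fun_prop
    refine Continuous.subtype_mk (continuous_pi fun i => Fin.cases ?_ (fun i => ?_) i) _
    · simp only [Fin.cons_zero]
      exact (Real.continuous_exp.comp (continuous_apply 0)).add
        (hf.comp_continuous hexp fun y i => Real.exp_pos _)
    · simp only [Fin.cons_succ]
      exact (continuous_apply i).comp hexp

theorem topC_pos_iff {t012 e01 e10 e12 e21 : ℝ} (h01 : 0 < e01) (h10 : 0 < e10) (h12 : 0 < e12)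
    (h21 : 0 < e21) : 0 < topC t012 e01 e10 e12 e21 ↔ pC e01 e10 e12 e21 < t012 := by
  rw [pC, div_lt_iff₀ (by positivity), topC]
  constructor <;> intro h <;> linarith

theorem botC_pos_iff {t012 e01 e10 e12 e21 : ℝ} (h21 : 0 < e21) :
    0 < botC t012 e01 e10 e12 e21 ↔ qC e01 e10 e12 e21 < t012 := by
  rw [qC, div_lt_iff₀ (by positivity), botC]
  constructor <;> intro h <;> linarith

theorem pC_pos {e01 e10 e12 e21 : ℝ} (h01 : 0 < e01) (h10 : 0 < e10) (h12 : 0 < e12)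
    (h21 : 0 < e21) : 0 < pC e01 e10 e12 e21 := by
  unfold pC
  positivity

theorem continuousOn_max_pC_qC :
    ContinuousOn
      (fun y : Fin 4 → ℝ => max (pC (y 0) (y 1) (y 2) (y 3)) (qC (y 0) (y 1) (y 2) (y 3)))
      {y | ∀ i, 0 < y i} := by
  unfold pC qC
  refine ContinuousOn.sup (ContinuousOn.div (by fun_prop) (by fun_prop) fun y hy => ?_)
    (ContinuousOn.div (by fun_prop) (by fun_prop) fun y hy => ?_)
  · have h0 := hy 0
    have h1 := hy 1
    have h2 := hy 2
    have h3 := hy 3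
    positivity
  · have h3 := hy 3
    positivity

theorem cyanPosPiece_eq_max_lt :
    cyanPosPiece =
      {x : Fin 5 → ℝ | (∀ i, 0 < x i) ∧
        max (pC (x 1) (x 2) (x 3) (x 4)) (qC (x 1) (x 2) (x 3) (x 4)) < x 0} := by
  ext x
  refine and_congr_right fun hx => ?_
  rw [topC_pos_iff (hx 1) (hx 2) (hx 3) (hx 4), botC_pos_iff (hx 4), max_lt_iff]

theorem cyanPosPiece_eq_strictEpigraph :
    cyanPosPiece =
      {x : Fin 5 → ℝ | (∀ i, 0 < Fin.tail x i) ∧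
        (fun y : Fin 4 → ℝ => max (pC (y 0) (y 1) (y 2) (y 3)) (qC (y 0) (y 1) (y 2) (y 3)))
          (Fin.tail x) < x 0} := by
  rw [cyanPosPiece_eq_max_lt]
  ext x
  constructor
  · rintro ⟨hx, h⟩
    exact ⟨fun i => hx i.succ, h⟩
  · rintro ⟨hx, h⟩
    refine ⟨Fin.cases ?_ hx, h⟩
    exact (pC_pos (hx 0) (hx 1) (hx 2) (hx 3)).trans ((le_max_left _ _).trans_lt h)

theorem stmt_6 :
    cyanPosPiece =
      {x : Fin 5 → ℝ | (∀ i, 0 < x i) ∧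
        max (pC (x 1) (x 2) (x 3) (x 4)) (qC (x 1) (x 2) (x 3) (x 4)) < x 0} ∧
    Nonempty (↥cyanPosPiece ≃ₜ (Fin 5 → ℝ)) :=
  ⟨cyanPosPiece_eq_max_lt,
    ⟨(Homeomorph.setCongr cyanPosPiece_eq_strictEpigraph).trans
      (strictEpigraphHomeomorph _ continuousOn_max_pC_qC)⟩⟩
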